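/- Let n ≥ 1 be an integer, F(θ) = √(∑_{k=0}^{n−1} (cos θ)^{2k}), and let Q* ∈ ℝ with Q* ∉ {0, 1, −1}. For the vector field X on ℝ³ given by X(θ,T,Q) = ( 3Q(T−1)·F(θ)²·sin(2θ)/(2n) − T·F(θ), 3Q(T−1)²·T·(1−(cos θ)^{2n})/n, −3(Q²−1)(T−1)(1−(cos θ)^{2n}) ), the point (θ,T,Q) = (0,0,Q*) is an equilibrium of X and it is unstable (it is not Lyapunov stable). -/

import Mathlib

open Real Filter

noncomputable section

/-- Lyapunov stability of the equilibrium `p` of the vector field `X` on the domain `D`. -/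
def LyapunovStable {E : Type*} [NormedAddCommGroup E] [NormedSpace ℝ E]
    (X : E → E) (D : Set E) (p : E) : Prop :=
  ∀ ε > 0, ∃ δ > 0, ∀ γ : ℝ → E,
    (∀ t : ℝ, 0 ≤ t → γ t ∈ D) →
    (∀ t : ℝ, 0 ≤ t → HasDerivAt γ (X (γ t)) t) →
    ‖γ 0 - p‖ < δ → ∀ t : ℝ, 0 ≤ t → ‖γ t - p‖ < ε

/-- `F θ = √(∑_{k=0}^{n-1} (cos θ)^{2k})`. -/
def F (n : ℕ) (θ : ℝ) : ℝ :=
  Real.sqrt (∑ k ∈ Finset.range n, Real.cos θ ^ (2 * k))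

/-- The unwrapped vector field (flat, Λ ≠ 0, detailed balance, power-law potential);
coordinates `(θ, T, Q)`. -/
def X8 (n : ℕ) (p : ℝ × ℝ × ℝ) : ℝ × ℝ × ℝ :=
  (3 * p.2.2 * (p.2.1 - 1) * F n p.1 ^ 2 * Real.sin (2 * p.1) / (2 * n) - p.2.1 * F n p.1,
   3 * p.2.2 * (p.2.1 - 1) ^ 2 * p.2.1 * (1 - Real.cos p.1 ^ (2 * n)) / n,
   -3 * (p.2.2 ^ 2 - 1) * (p.2.1 - 1) * (1 - Real.cos p.1 ^ (2 * n)))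

open Set Metric in
/-- A bounded, globally Lipschitz vector field has solutions on arbitrarily long intervals. -/
theorem exists_hasDerivAt_of_lipschitzWith_of_bounded {E : Type*} [NormedAddCommGroup E]
    [NormedSpace ℝ E] [CompleteSpace E] {Y : E → E} {K : NNReal} {L : ℝ}
    (hK : LipschitzWith K Y) (hL : ∀ x, ‖Y x‖ ≤ L) (x₀ : E) {N : ℝ} (hN : 0 < N) :
    ∃ α : ℝ → E, α 0 = x₀ ∧ ∀ t ∈ Ioo (-N) N, HasDerivAt α (Y (α t)) t := by
  have hL0 : 0 ≤ L := (norm_nonneg _).trans (hL x₀)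
  have hpl : IsPicardLindelof (fun _ ↦ Y) (tmin := -N) (tmax := N)
      ⟨0, by constructor <;> linarith⟩ x₀ (L.toNNReal * N.toNNReal) 0 L.toNNReal K := by
    refine .of_time_independent (fun x _ ↦ ?_) hK.lipschitzOnWith ?_
    · rw [Real.coe_toNNReal _ hL0]; exact hL x
    · simp [Real.coe_toNNReal _ hL0, Real.coe_toNNReal _ hN.le]
  obtain ⟨α, h0, hα⟩ := hpl.exists_eq_forall_mem_Icc_hasDerivWithinAt₀
  exact ⟨α, h0, fun t ht ↦ (hα t (Ioo_subset_Icc_self ht)).hasDerivAt (Icc_mem_nhds ht.1 ht.2)⟩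

open Set Metric in
/-- A `C¹` vector field has a solution on `[0, N]` as soon as all of its solutions on shorter
intervals are bounded by a common constant. -/
theorem exists_hasDerivAt_Icc_of_bounded {E : Type*} [NormedAddCommGroup E]
    [NormedSpace ℝ E] [FiniteDimensional ℝ E] {X : E → E} (hX : ContDiff ℝ 1 X) (x₀ : E) {N R : ℝ}
    (hN : 0 < N)
    (hR : ∀ a ∈ Icc 0 N, ∀ γ : ℝ → E, γ 0 = x₀ →
      (∀ t ∈ Icc 0 a, HasDerivAt γ (X (γ t)) t) → ‖γ a‖ ≤ R) :
    ∃ γ : ℝ → E, γ 0 = x₀ ∧ ∀ t ∈ Icc 0 N, HasDerivAt γ (X (γ t)) t := by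
  have : CompleteSpace E := FiniteDimensional.complete ℝ E
  let χ : ContDiffBump (0 : E) := ⟨|R| + ‖x₀‖ + 1, |R| + ‖x₀‖ + 2, by positivity, by linarith⟩
  set r : ℝ := |R| + ‖x₀‖ + 1 with hr
  have hχ : ∀ x : E, ‖x‖ ≤ r → χ x = 1 := fun x hx ↦
    χ.one_of_mem_closedBall (by simpa using hx)
  let Y : E → E := fun x ↦ χ x • X x
  have hYX : ∀ x : E, ‖x‖ ≤ r → Y x = X x := fun x hx ↦ by simp [Y, hχ x hx]
  have hYc : ContDiff ℝ 1 Y := χ.contDiff.smul hX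
  have hYs : HasCompactSupport Y := χ.hasCompactSupport.smul_right
  obtain ⟨K, hK⟩ := ContDiff.lipschitzWith_of_hasCompactSupport (𝕂 := ℝ) hYs hYc one_ne_zero
  obtain ⟨L, hL⟩ := hYs.exists_bound_of_continuous hYc.continuous
  obtain ⟨γ, h0, hγ⟩ := exists_hasDerivAt_of_lipschitzWith_of_bounded hK hL x₀
    (show 0 < N + 1 by linarith)
  have hγ' : ∀ t ∈ Icc 0 N, HasDerivAt γ (Y (γ t)) t := fun t ht ↦
    hγ t ⟨by linarith [ht.1], by linarith [ht.2]⟩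
  have hcont : ContinuousOn (fun t ↦ ‖γ t‖) (Icc 0 N) := fun t ht ↦
    (hγ' t ht).continuousAt.norm.continuousWithinAt
  have hmem : ∀ t ∈ Icc 0 N, ‖γ t‖ < r := by
    by_contra! hcon
    obtain ⟨t₁, ht₁, hrt₁⟩ := hcon
    let S := Icc 0 N ∩ (fun t ↦ ‖γ t‖) ⁻¹' Ici r
    have hS : IsClosed S := hcont.preimage_isClosed_of_isClosed isClosed_Icc isClosed_Ici
    have hSbdd : BddBelow S := ⟨0, fun t ht ↦ ht.1.1⟩
    have hmin : sInf S ∈ S := hS.csInf_mem ⟨t₁, ht₁, hrt₁⟩ hSbdd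
    set τ := sInf S
    have hlt : ∀ t ∈ Ico 0 τ, ‖γ t‖ < r := by
      intro t ht
      by_contra! h
      exact absurd (csInf_le hSbdd ⟨⟨ht.1, ht.2.le.trans hmin.1.2⟩, h⟩) (not_le.mpr ht.2)
    have hτ : 0 < τ := by
      rcases hmin.1.1.eq_or_lt with h | h
      · have := hmin.2
        simp only [mem_preimage, mem_Ici, ← h, h0] at this
        linarith [abs_nonneg R]
      · exact h
    have hle : ‖γ τ‖ ≤ r := by
      have hc : ContinuousWithinAt (fun t ↦ ‖γ t‖) (Ico 0 τ) τ :=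
        (hγ' τ hmin.1).continuousAt.norm.continuousWithinAt
      have hτc : τ ∈ closure (Ico 0 τ) := by
        rw [closure_Ico hτ.ne]; exact ⟨hτ.le, le_rfl⟩
      have := hc.mem_closure_image hτc
      exact closure_minimal (t := Iic r) (by rintro _ ⟨t, ht, rfl⟩; exact (hlt t ht).le)
        isClosed_Iic this
    have hfin := hR τ hmin.1 γ h0 fun t ht ↦ by
      rw [← hYX]
      · exact hγ' t ⟨ht.1, ht.2.trans hmin.1.2⟩
      · rcases ht.2.eq_or_lt with h | h
        · rwa [h]
        · exact (hlt t ⟨ht.1, h⟩).le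
    have : r ≤ ‖γ τ‖ := hmin.2
    linarith [le_abs_self R, norm_nonneg x₀]
  exact ⟨γ, h0, fun t ht ↦ hYX _ (hmem t ht).le ▸ hγ' t ht⟩

open Set Metric in
/-- A `C¹` vector field whose solutions from `x₀` are bounded on bounded time intervals has a
solution from `x₀` defined for all nonnegative times. -/
theorem exists_global_solution_of_bounded {E : Type*} [NormedAddCommGroup E]
    [NormedSpace ℝ E] [FiniteDimensional ℝ E] {X : E → E} (hX : ContDiff ℝ 1 X) (x₀ : E)
    (hR : ∀ N : ℝ, 0 < N → ∃ R, ∀ a ∈ Icc 0 N, ∀ γ : ℝ → E, γ 0 = x₀ →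
      (∀ t ∈ Icc 0 a, HasDerivAt γ (X (γ t)) t) → ‖γ a‖ ≤ R) :
    ∃ γ : ℝ → E, γ 0 = x₀ ∧ ∀ t, 0 ≤ t → HasDerivAt γ (X (γ t)) t := by
  have hex : ∀ m : ℕ, ∃ γ : ℝ → E, γ 0 = x₀ ∧
      ∀ t ∈ Icc (0 : ℝ) (m + 1), HasDerivAt γ (X (γ t)) t := fun m ↦ by
    obtain ⟨R, h⟩ := hR (m + 1) (by positivity)
    exact exists_hasDerivAt_Icc_of_bounded hX x₀ (by positivity) h
  choose g hg0 hg using hex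
  have huniq : ∀ (m k : ℕ) (s : ℝ), 0 ≤ s → s ≤ m + 1 → s ≤ k + 1 → g m s = g k s := by
    intro m k s hs hsm hsk
    obtain ⟨R, h⟩ := hR (s + 1) (by positivity)
    have hb : ∀ j : ℕ, s ≤ j + 1 → ∀ t ∈ Icc 0 s, g j t ∈ closedBall (0 : E) R := by
      intro j hj t ht
      rw [mem_closedBall_zero_iff]
      exact h t ⟨ht.1, by linarith [ht.2]⟩ _ (hg0 j) fun u hu ↦
        hg j u ⟨hu.1, by linarith [hu.2, ht.2]⟩
    have hd : ∀ j : ℕ, s ≤ j + 1 → ∀ t ∈ Icc 0 s, HasDerivAt (g j) (X (g j t)) t :=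
      fun j hj t ht ↦ hg j t ⟨ht.1, ht.2.trans hj⟩
    obtain ⟨K, hK⟩ := hX.contDiffOn.exists_lipschitzOnWith (n := 1) one_ne_zero
      (convex_closedBall (0 : E) R) (isCompact_closedBall (0 : E) R)
    have := ODE_solution_unique_of_mem_Icc_right (v := fun _ ↦ X) (K := K)
      (s := fun _ ↦ closedBall (0 : E) R) (a := 0) (b := s) (fun _ _ ↦ hK)
      (fun t ht ↦ (hd m hsm t ht).continuousAt.continuousWithinAt)
      (fun t ht ↦ (hd m hsm t (Ico_subset_Icc_self ht)).hasDerivWithinAt)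
      (fun t ht ↦ hb m hsm t (Ico_subset_Icc_self ht))
      (fun t ht ↦ (hd k hsk t ht).continuousAt.continuousWithinAt)
      (fun t ht ↦ (hd k hsk t (Ico_subset_Icc_self ht)).hasDerivWithinAt)
      (fun t ht ↦ hb k hsk t (Ico_subset_Icc_self ht)) (by rw [hg0, hg0])
    exact this ⟨hs, le_rfl⟩
  refine ⟨fun t ↦ g ⌈t⌉₊ t, by simp [hg0], fun t ht ↦ ?_⟩
  have hev : (fun t ↦ g ⌈t⌉₊ t) =ᶠ[nhds t] g ⌈t⌉₊ := by
    have htl : t < ⌈t⌉₊ + 1 := (Nat.le_ceil t).trans_lt (lt_add_one _)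
    rcases ht.eq_or_lt with rfl | h
    · filter_upwards [Iio_mem_nhds htl] with s hs
      rcases le_total s 0 with h | h
      · simp [Nat.ceil_eq_zero.mpr h]
      · exact huniq _ _ s h ((Nat.le_ceil s).trans (by linarith)) hs.le
    · filter_upwards [Ioo_mem_nhds h htl] with s hs
      exact huniq _ _ s hs.1.le ((Nat.le_ceil s).trans (by linarith)) hs.2.le
  exact (hg _ t ⟨ht, (Nat.le_ceil t).trans (by linarith)⟩).congr_of_eventuallyEq hev

open Set in
/-- Solutions of a scalar linear equation `y' = g y` are multiples of a positive function. -/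
theorem exists_pos_eq_mul_of_hasDerivAt_mul {y g : ℝ → ℝ} {a : ℝ}
    (hg : ContinuousOn g (Icc 0 a)) (hy : ∀ t ∈ Icc 0 a, HasDerivAt y (g t * y t) t) :
    ∀ t ∈ Icc 0 a, ∃ c > 0, y t = y 0 * c := by
  intro t ht
  have ha : 0 ≤ a := ht.1.trans ht.2
  have hc : Continuous (IccExtend ha ((Icc 0 a).domRestrict g)) := hg.domRestrict.Icc_extend'
  set G : ℝ → ℝ := IccExtend ha ((Icc 0 a).domRestrict g)
  have hG : ∀ s ∈ Icc 0 a, G s = g s := fun s hs ↦ by simp [G, IccExtend_of_mem _ _ hs, domRestrict]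
  let I : ℝ → ℝ := fun s ↦ ∫ u in (0 : ℝ)..s, G u
  have hI : ∀ s, HasDerivAt I (G s) s := fun s ↦ hc.integral_hasStrictDerivAt 0 s |>.hasDerivAt
  have hz : ∀ s ∈ Icc 0 a, HasDerivAt (fun s ↦ y s * exp (-I s)) 0 s := fun s hs ↦ by
    refine ((hy s hs).mul (hI s).neg.exp).congr_deriv ?_
    rw [hG s hs]; ring
  have := constant_of_has_deriv_right_zero
    (fun s hs ↦ (hz s hs).continuousAt.continuousWithinAt)
    (fun s hs ↦ (hz s (Ico_subset_Icc_self hs)).hasDerivWithinAt) t ht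
  refine ⟨exp (I t), exp_pos _, ?_⟩
  simp only [I, intervalIntegral.integral_same, neg_zero, exp_zero, mul_one] at this
  rw [← this, mul_assoc, ← exp_add]
  simp [I]

open Set in
theorem add_mul_le_of_le_hasDerivAt {f f' : ℝ → ℝ} {a k : ℝ} (ha : 0 ≤ a)
    (hf : ∀ t ∈ Icc 0 a, HasDerivAt f (f' t) t) (hk : ∀ t ∈ Icc 0 a, k ≤ f' t) :
    f 0 + k * a ≤ f a := by
  have hd : ∀ t ∈ interior (Icc 0 a), HasDerivAt f (f' t) t := fun t ht ↦ hf t (interior_subset ht)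
  have := (convex_Icc 0 a).mul_sub_le_image_sub_of_le_deriv
    (fun t ht ↦ (hf t ht).continuousAt.continuousWithinAt)
    (fun t ht ↦ (hd t ht).differentiableAt.differentiableWithinAt)
    (C := k) (fun t ht ↦ by rw [(hd t ht).deriv]; exact hk t (interior_subset ht))
    0 ⟨le_rfl, ha⟩ a ⟨ha, le_rfl⟩ ha
  linarith

open Set in
theorem le_add_mul_of_hasDerivAt_le {f f' : ℝ → ℝ} {a k : ℝ} (ha : 0 ≤ a)
    (hf : ∀ t ∈ Icc 0 a, HasDerivAt f (f' t) t) (hk : ∀ t ∈ Icc 0 a, f' t ≤ k) :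
    f a ≤ f 0 + k * a := by
  have := add_mul_le_of_le_hasDerivAt ha (fun t ht ↦ (hf t ht).neg)
    (k := -k) (fun t ht ↦ neg_le_neg (hk t ht))
  simp only [Pi.neg_apply] at this
  linarith

theorem one_le_sum_cos_pow {n : ℕ} (hn : 1 ≤ n) (θ : ℝ) :
    1 ≤ ∑ k ∈ Finset.range n, cos θ ^ (2 * k) := by
  have := Finset.single_le_sum (f := fun k ↦ cos θ ^ (2 * k)) (s := Finset.range n)
    (fun k _ ↦ (even_two_mul k).pow_nonneg _) (Finset.mem_range.mpr hn)
  simpa using this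

theorem F_sq {n : ℕ} (θ : ℝ) : F n θ ^ 2 = ∑ k ∈ Finset.range n, cos θ ^ (2 * k) :=
  sq_sqrt (Finset.sum_nonneg fun k _ ↦ (even_two_mul k).pow_nonneg _)

theorem one_le_F {n : ℕ} (hn : 1 ≤ n) (θ : ℝ) : 1 ≤ F n θ :=
  one_le_sqrt.mpr (one_le_sum_cos_pow hn θ)

theorem F_sq_le {n : ℕ} (θ : ℝ) : F n θ ^ 2 ≤ n := by
  rw [F_sq]
  calc _ ≤ ∑ _k ∈ Finset.range n, (1 : ℝ) := Finset.sum_le_sum fun k _ ↦ by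
        rw [pow_mul]; exact pow_le_one₀ (sq_nonneg _) (cos_sq_le_one θ)
    _ = n := by simp

theorem F_le {n : ℕ} (hn : 1 ≤ n) (θ : ℝ) : F n θ ≤ n := by
  nlinarith [one_le_F hn θ, F_sq_le (n := n) θ]

theorem F_sq_mul_sin_sq {n : ℕ} (θ : ℝ) : F n θ ^ 2 * sin θ ^ 2 = 1 - cos θ ^ (2 * n) := by
  rw [F_sq, sin_sq, pow_mul, ← geom_sum_mul_neg (cos θ ^ 2) n]
  simp only [pow_mul]

theorem contDiff_F {n : ℕ} (hn : 1 ≤ n) : ContDiff ℝ 1 (F n) := by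
  refine ContDiff.sqrt (ContDiff.sum fun k _ ↦ contDiff_cos.pow _) fun θ ↦ ?_
  have := one_le_sum_cos_pow hn θ
  positivity

theorem contDiff_X8 {n : ℕ} (hn : 1 ≤ n) : ContDiff ℝ 1 (X8 n) := by
  have hF : ContDiff ℝ 1 fun p : ℝ × ℝ × ℝ ↦ F n p.1 := (contDiff_F hn).comp contDiff_fst
  unfold X8
  fun_prop

/-- `(θ, T, Q)` solves the system on `[0, a]`. -/
def SolvesUpTo (n : ℕ) (a : ℝ) (θ T Q : ℝ → ℝ) : Prop :=
  ∀ t ∈ Set.Icc 0 a,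
    HasDerivAt θ (3 * Q t * (T t - 1) * F n (θ t) ^ 2 * (sin (θ t) * cos (θ t)) / n
      - T t * F n (θ t)) t ∧
    HasDerivAt T (3 * Q t * (T t - 1) ^ 2 * T t * (F n (θ t) ^ 2 * sin (θ t) ^ 2) / n) t ∧
    HasDerivAt Q (-3 * (Q t ^ 2 - 1) * (T t - 1) * (F n (θ t) ^ 2 * sin (θ t) ^ 2)) t

theorem solvesUpTo_of_hasDerivAt {n : ℕ} (hn : 1 ≤ n) {a : ℝ} {γ : ℝ → ℝ × ℝ × ℝ}
    (h : ∀ t ∈ Set.Icc 0 a, HasDerivAt γ (X8 n (γ t)) t) :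
    SolvesUpTo n a (fun t ↦ (γ t).1) (fun t ↦ (γ t).2.1) (fun t ↦ (γ t).2.2) := by
  intro t ht
  have h1 := (ContinuousLinearMap.fst ℝ ℝ (ℝ × ℝ)).hasFDerivAt.comp_hasDerivAt t (h t ht)
  have h2 := (ContinuousLinearMap.snd ℝ ℝ (ℝ × ℝ)).hasFDerivAt.comp_hasDerivAt t (h t ht)
  have h3 := (ContinuousLinearMap.fst ℝ ℝ ℝ).hasFDerivAt.comp_hasDerivAt t h2
  have h4 := (ContinuousLinearMap.snd ℝ ℝ ℝ).hasFDerivAt.comp_hasDerivAt t h2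
  have hn0 : (n : ℝ) ≠ 0 := by positivity
  refine ⟨h1.congr_deriv ?_, h3.congr_deriv ?_, h4.congr_deriv ?_⟩
  · simp only [X8, ContinuousLinearMap.coe_fst', sin_two_mul]
    field_simp
  · simp only [X8, ContinuousLinearMap.coe_fst', ContinuousLinearMap.coe_snd', F_sq_mul_sin_sq]
  · simp only [X8, ContinuousLinearMap.coe_snd', F_sq_mul_sin_sq]

namespace SolvesUpTo

variable {n : ℕ} {a : ℝ} {θ T Q : ℝ → ℝ}

theorem continuousOn_θ (h : SolvesUpTo n a θ T Q) : ContinuousOn θ (Set.Icc 0 a) :=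
  fun t ht ↦ (h t ht).1.continuousAt.continuousWithinAt

theorem continuousOn_T (h : SolvesUpTo n a θ T Q) : ContinuousOn T (Set.Icc 0 a) :=
  fun t ht ↦ (h t ht).2.1.continuousAt.continuousWithinAt

theorem continuousOn_Q (h : SolvesUpTo n a θ T Q) : ContinuousOn Q (Set.Icc 0 a) :=
  fun t ht ↦ (h t ht).2.2.continuousAt.continuousWithinAt

theorem continuousOn_F (h : SolvesUpTo n a θ T Q) (hn : 1 ≤ n) :
    ContinuousOn (fun t ↦ F n (θ t)) (Set.Icc 0 a) :=
  (contDiff_F hn).continuous.comp_continuousOn h.continuousOn_θ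

theorem T_eq (h : SolvesUpTo n a θ T Q) (hn : 1 ≤ n) :
    ∀ t ∈ Set.Icc 0 a, ∃ c > 0, T t = T 0 * c := by
  have := h.continuousOn_F hn
  have := h.continuousOn_θ
  have := h.continuousOn_T
  have := h.continuousOn_Q
  refine exists_pos_eq_mul_of_hasDerivAt_mul
    (g := fun t ↦ 3 * Q t * (T t - 1) ^ 2 * (F n (θ t) ^ 2 * sin (θ t) ^ 2) / n)
    (by fun_prop) fun t ht ↦ (h t ht).2.1.congr_deriv (by ring)

theorem one_sub_T_eq (h : SolvesUpTo n a θ T Q) (hn : 1 ≤ n) :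
    ∀ t ∈ Set.Icc 0 a, ∃ c > 0, 1 - T t = (1 - T 0) * c := by
  have := h.continuousOn_F hn
  have := h.continuousOn_θ
  have := h.continuousOn_T
  have := h.continuousOn_Q
  refine exists_pos_eq_mul_of_hasDerivAt_mul (y := fun t ↦ 1 - T t)
    (g := fun t ↦ -(3 * Q t * (1 - T t) * T t * (F n (θ t) ^ 2 * sin (θ t) ^ 2) / n))
    (by fun_prop) fun t ht ↦ ((h t ht).2.1.const_sub 1).congr_deriv (by ring)

theorem Q_sub_one_eq (h : SolvesUpTo n a θ T Q) (hn : 1 ≤ n) :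
    ∀ t ∈ Set.Icc 0 a, ∃ c > 0, Q t - 1 = (Q 0 - 1) * c := by
  have := h.continuousOn_F hn
  have := h.continuousOn_θ
  have := h.continuousOn_T
  have := h.continuousOn_Q
  refine exists_pos_eq_mul_of_hasDerivAt_mul (y := fun t ↦ Q t - 1)
    (g := fun t ↦ -3 * (Q t + 1) * (T t - 1) * (F n (θ t) ^ 2 * sin (θ t) ^ 2))
    (by fun_prop) fun t ht ↦ ((h t ht).2.2.sub_const 1).congr_deriv (by ring)

theorem Q_add_one_eq (h : SolvesUpTo n a θ T Q) (hn : 1 ≤ n) :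
    ∀ t ∈ Set.Icc 0 a, ∃ c > 0, Q t + 1 = (Q 0 + 1) * c := by
  have := h.continuousOn_F hn
  have := h.continuousOn_θ
  have := h.continuousOn_T
  have := h.continuousOn_Q
  refine exists_pos_eq_mul_of_hasDerivAt_mul (y := fun t ↦ Q t + 1)
    (g := fun t ↦ -3 * (Q t - 1) * (T t - 1) * (F n (θ t) ^ 2 * sin (θ t) ^ 2))
    (by fun_prop) fun t ht ↦ ((h t ht).2.2.add_const 1).congr_deriv (by ring)

theorem T_pos (h : SolvesUpTo n a θ T Q) (hn : 1 ≤ n) (hT : 0 < T 0) :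
    ∀ t ∈ Set.Icc 0 a, 0 < T t := fun t ht ↦ by
  obtain ⟨c, hc, e⟩ := h.T_eq hn t ht
  rw [e]; positivity

theorem T_eq_zero (h : SolvesUpTo n a θ T Q) (hn : 1 ≤ n) (hT : T 0 = 0) :
    ∀ t ∈ Set.Icc 0 a, T t = 0 := fun t ht ↦ by
  obtain ⟨c, hc, e⟩ := h.T_eq hn t ht
  rw [e, hT, zero_mul]

theorem T_lt_one (h : SolvesUpTo n a θ T Q) (hn : 1 ≤ n) (hT : T 0 < 1) :
    ∀ t ∈ Set.Icc 0 a, T t < 1 := fun t ht ↦ by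
  obtain ⟨c, hc, e⟩ := h.one_sub_T_eq hn t ht
  have := mul_pos (sub_pos.mpr hT) hc
  linarith

/-- As long as `0 ≤ T ≤ 1` and `Q` is bounded, the whole solution is bounded. -/
theorem norm_le (h : SolvesUpTo n a θ T Q) (hn : 1 ≤ n) (ha : 0 ≤ a) {B : ℝ}
    (hT0 : ∀ t ∈ Set.Icc 0 a, 0 ≤ T t) (hT1 : ∀ t ∈ Set.Icc 0 a, T t ≤ 1)
    (hQ : ∀ t ∈ Set.Icc 0 a, |Q t| ≤ B) :
    ‖(θ a, T a, Q a)‖ ≤ |θ 0| + (3 * B + n) * a + 1 + B := by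
  have haa : a ∈ Set.Icc 0 a := ⟨ha, le_rfl⟩
  have hB : 0 ≤ B := (abs_nonneg _).trans (hQ a haa)
  have hn0 : (0 : ℝ) < n := by positivity
  have hθ : |θ a - θ 0| ≤ (3 * B + n) * a := by
    have := norm_image_sub_le_of_norm_deriv_le_segment' (fun t ht ↦ (h t ht).1.hasDerivWithinAt)
      (C := 3 * B + n) (fun t ht ↦ ?_) a haa
    · simpa using this
    have ht' := Set.Ico_subset_Icc_self ht
    have h1 : |3 * Q t * (T t - 1) * F n (θ t) ^ 2 * (sin (θ t) * cos (θ t)) / n| ≤ 3 * B := by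
      rw [abs_div, abs_of_pos hn0, div_le_iff₀ hn0]
      simp only [abs_mul, abs_pow, sq_abs, abs_of_pos (three_pos : (0 : ℝ) < 3)]
      have e1 : |T t - 1| ≤ 1 := by
        rw [abs_le]; constructor <;> linarith [hT0 t ht', hT1 t ht']
      have e2 : |sin (θ t)| * |cos (θ t)| ≤ 1 :=
        mul_le_one₀ (abs_sin_le_one _) (abs_nonneg _) (abs_cos_le_one _)
      calc _ ≤ 3 * B * 1 * n * 1 := by
            gcongr
            · exact hQ t ht'
            · exact F_sq_le _
        _ = _ := by ring
    have h2 : |T t * F n (θ t)| ≤ n := by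
      have := one_le_F hn (θ t)
      rw [abs_of_nonneg (mul_nonneg (hT0 t ht') (by linarith))]
      calc _ ≤ 1 * (n : ℝ) := by
            gcongr
            · exact hT1 t ht'
            · exact F_le hn _
        _ = n := one_mul _
    exact (norm_sub_le _ _).trans (add_le_add h1 h2)
  have hc : 0 ≤ (3 * B + n) * a := by positivity
  rw [Prod.norm_def, Prod.norm_def]
  refine max_le ?_ (max_le ?_ ?_)
  · rw [Real.norm_eq_abs]
    have := abs_sub_abs_le_abs_sub (θ a) (θ 0)
    linarith
  · rw [Real.norm_eq_abs, abs_of_nonneg (hT0 a haa)]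
    linarith [hT1 a haa, abs_nonneg (θ 0)]
  · rw [Real.norm_eq_abs]
    linarith [hQ a haa, abs_nonneg (θ 0)]

/-- On the invariant plane `T = 0` the quantity `(Q² - 1) / (cos θ)^{2n}` is conserved. -/
theorem abs_Q_le_of_T_eq_zero (h : SolvesUpTo n a θ T Q) (hn : 1 ≤ n) (hT : T 0 = 0)
    (hθ : 0 < cos (θ 0)) :
    ∀ t ∈ Set.Icc 0 a, |Q t| ≤ 1 + |Q 0 ^ 2 - 1| / cos (θ 0) ^ (2 * n) := by
  have hcF := h.continuousOn_F hn
  have hcθ := h.continuousOn_θ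
  have hcT := h.continuousOn_T
  have hcQ := h.continuousOn_Q
  have hn0 : (n : ℝ) ≠ 0 := by positivity
  set c₀ := cos (θ 0) ^ (2 * n) with hc₀
  have hc₀pos : 0 < c₀ := by positivity
  intro t ht
  have key := exists_pos_eq_mul_of_hasDerivAt_mul
    (y := fun t ↦ (Q t ^ 2 - 1) * c₀ - (Q 0 ^ 2 - 1) * cos (θ t) ^ (2 * n))
    (g := fun t ↦ 6 * Q t * (F n (θ t) ^ 2 * sin (θ t) ^ 2)) (a := a) (by fun_prop)
    (fun t ht ↦ by
      obtain ⟨h1, -, h3⟩ := h t ht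
      rw [h.T_eq_zero hn hT t ht] at h1 h3
      refine ((((h3.pow 2).sub_const 1).mul_const c₀).sub
        ((h1.cos.pow (2 * n)).const_mul (Q 0 ^ 2 - 1))).congr_deriv ?_
      obtain ⟨m, rfl⟩ : ∃ m, n = m + 1 := ⟨n - 1, by omega⟩
      have e : 2 * (m + 1) - 1 = 2 * m + 1 := by omega
      rw [e]
      push_cast at hn0 ⊢
      field_simp
      ring) t ht
  obtain ⟨c, -, e⟩ := key
  simp only [hc₀, sub_self, zero_mul] at e
  have e' : Q t ^ 2 - 1 = (Q 0 ^ 2 - 1) * cos (θ t) ^ (2 * n) / c₀ := by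
    rw [eq_div_iff hc₀pos.ne']; linarith
  have hb : Q t ^ 2 - 1 ≤ |Q 0 ^ 2 - 1| / c₀ := by
    rw [e']
    gcongr
    calc _ ≤ |Q 0 ^ 2 - 1| * cos (θ t) ^ (2 * n) :=
          mul_le_mul_of_nonneg_right (le_abs_self _) ((even_two_mul n).pow_nonneg _)
      _ ≤ _ := mul_le_of_le_one_right (abs_nonneg _) (by
          rw [pow_mul]; exact pow_le_one₀ (sq_nonneg _) (cos_sq_le_one _))
  have hM : 0 ≤ |Q 0 ^ 2 - 1| / c₀ := by positivity
  exact abs_le_of_sq_le_sq (by nlinarith) (by positivity)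

theorem abs_Q_lt_one (h : SolvesUpTo n a θ T Q) (hn : 1 ≤ n) (hQ : |Q 0| < 1) :
    ∀ t ∈ Set.Icc 0 a, |Q t| < 1 := by
  intro t ht
  obtain ⟨c, hc, e⟩ := h.Q_sub_one_eq hn t ht
  obtain ⟨d, hd, e'⟩ := h.Q_add_one_eq hn t ht
  rw [abs_lt] at hQ ⊢
  constructor <;> nlinarith

theorem one_lt_Q (h : SolvesUpTo n a θ T Q) (hn : 1 ≤ n) (hQ : 1 < Q 0) :
    ∀ t ∈ Set.Icc 0 a, 1 < Q t := by
  intro t ht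
  obtain ⟨c, hc, e⟩ := h.Q_sub_one_eq hn t ht
  nlinarith

/-- The quantity `(Q² - 1) ((1 - T) / T)²` is nondecreasing while `0 < T < 1 < Q`. -/
theorem mul_T_le (h : SolvesUpTo n a θ T Q) (hn : 1 ≤ n) (hT0 : 0 < T 0) (hT1 : T 0 < 1)
    (hQ : 1 < Q 0) (hP : n ^ 2 ≤ (Q 0 ^ 2 - 1) * ((1 - T 0) / T 0) ^ 2) :
    ∀ t ∈ Set.Icc 0 a, n * T t ≤ Q t * (1 - T t) := by
  intro t ht
  have hn0 : (1 : ℝ) ≤ n := by exact_mod_cast hn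
  have hTp := h.T_pos hn hT0
  have hTl := h.T_lt_one hn hT1
  have hQp := h.one_lt_Q hn hQ
  have key := add_mul_le_of_le_hasDerivAt (k := 0) ht.1
    (f := fun t ↦ (Q t ^ 2 - 1) * ((1 - T t) / T t) ^ 2)
    (f' := fun t ↦ (Q t ^ 2 - 1) * ((1 - T t) / T t) ^ 2 *
      (6 * Q t * (1 - T t) * (F n (θ t) ^ 2 * sin (θ t) ^ 2) * ((n - 1) / n)))
    (fun s hs ↦ by
      have hs' : s ∈ Set.Icc 0 a := ⟨hs.1, hs.2.trans ht.2⟩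
      obtain ⟨-, h2, h3⟩ := h s hs'
      have hne := (hTp s hs').ne'
      refine (((h3.pow 2).sub_const 1).mul
        (((h2.const_sub 1).div h2 hne).pow 2)).congr_deriv ?_
      simp only [Pi.pow_apply, Pi.div_apply, Nat.cast_ofNat, Nat.add_one_sub_one, pow_one]
      field_simp
      ring)
    (fun s hs ↦ by
      have hs' : s ∈ Set.Icc 0 a := ⟨hs.1, hs.2.trans ht.2⟩
      have a1 := hQp s hs'
      have a2 : 0 ≤ 1 - T s := by linarith [hTl s hs']
      have a3 : 0 ≤ Q s ^ 2 - 1 := by nlinarith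
      have a4 : 0 ≤ (n : ℝ) - 1 := by linarith
      have a5 := hTp s hs'
      positivity)
  have hTt := hTp t ht
  have hle : (n : ℝ) ^ 2 ≤ Q t ^ 2 * ((1 - T t) / T t) ^ 2 := by
    have := sq_nonneg ((1 - T t) / T t)
    simp only [zero_mul, add_zero] at key
    linarith
  rw [← mul_pow] at hle
  have hQt := hQp t ht
  have h1T : 0 < 1 - T t := by linarith [hTl t ht]
  have := (pow_le_pow_iff_left₀ (by positivity) (by positivity) two_ne_zero).mp hle
  rwa [← mul_div_assoc, le_div_iff₀ hTt] at this

theorem θ_mem_Icc (h : SolvesUpTo n a θ T Q) (hn : 1 ≤ n) (hT0 : 0 < T 0)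
    (hθ : θ 0 = 0) (hle : ∀ t ∈ Set.Icc 0 a, n * T t ≤ Q t * (1 - T t)) :
    ∀ t ∈ Set.Icc 0 a, θ t ∈ Set.Icc (-(π / 4)) 0 := by
  intro t ht
  have hTp := h.T_pos hn hT0
  constructor
  · have := image_le_of_deriv_right_lt_deriv_boundary (f := fun t ↦ -θ t) (B := fun _ ↦ π / 4)
      (B' := 0) h.continuousOn_θ.neg
      (fun s hs ↦ (h s (Set.Ico_subset_Icc_self hs)).1.neg.hasDerivWithinAt)
      (by simp only [hθ, neg_zero]; positivity) (fun s ↦ hasDerivAt_const _ _)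
      (fun s hs e ↦ by
        have hs' := Set.Ico_subset_Icc_self hs
        have e' : θ s = -(π / 4) := by linarith
        have hsc : sin (θ s) * cos (θ s) = -(1 / 2) := by
          rw [e', sin_neg, cos_neg, sin_pi_div_four, cos_pi_div_four]
          nlinarith [sq_sqrt (zero_le_two : (0 : ℝ) ≤ 2)]
        have hF := one_le_F hn (θ s)
        have hn0 : (0 : ℝ) < n := by positivity
        have hT := hTp s hs'
        rw [hsc, Pi.zero_apply, neg_lt_zero, sub_pos, lt_div_iff₀ hn0]
        have h1 := mul_le_mul_of_nonneg_right (hle s hs') (sq_nonneg (F n (θ s)))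
        have h2 : 0 < n * T s * F n (θ s) := by positivity
        nlinarith [mul_le_mul_of_nonneg_left hF h2.le]) ht
    linarith
  · refine image_le_of_deriv_right_lt_deriv_boundary (f := θ) (B := fun _ ↦ 0)
      (B' := 0) h.continuousOn_θ
      (fun s hs ↦ (h s (Set.Ico_subset_Icc_self hs)).1.hasDerivWithinAt)
      hθ.le (fun s ↦ hasDerivAt_const _ _) (fun s hs e ↦ ?_) ht
    have hF := one_le_F hn (θ s)
    have hT := hTp s (Set.Ico_subset_Icc_self hs)
    simp only [e, sin_zero, zero_mul, mul_zero, zero_div, zero_sub, Pi.zero_apply, neg_lt_zero]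
    rw [e] at hF
    positivity

/-- The quantity `log (Q² - 1) - 2 n θ` grows at most linearly. -/
theorem Q_le_of_one_lt (h : SolvesUpTo n a θ T Q) (hn : 1 ≤ n) (hT0 : 0 < T 0) (hT1 : T 0 < 1)
    (hQ : 1 < Q 0) (hθ : θ 0 = 0) (hP : n ^ 2 ≤ (Q 0 ^ 2 - 1) * ((1 - T 0) / T 0) ^ 2) :
    ∀ t ∈ Set.Icc 0 a, |Q t| ≤ 1 + exp (log (Q 0 ^ 2 - 1) + 2 * n ^ 2 * a) := by
  intro t ht
  have hn0 : (0 : ℝ) < n := by positivity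
  have hTp := h.T_pos hn hT0
  have hTl := h.T_lt_one hn hT1
  have hQp := h.one_lt_Q hn hQ
  have hθm := h.θ_mem_Icc hn hT0 hθ (h.mul_T_le hn hT0 hT1 hQ hP)
  have hQ2 : ∀ s ∈ Set.Icc 0 a, 0 < Q s ^ 2 - 1 := fun s hs ↦ by nlinarith [hQp s hs]
  have key := le_add_mul_of_hasDerivAt_le (k := 2 * n ^ 2) ht.1
    (f := fun t ↦ log (Q t ^ 2 - 1) - 2 * n * θ t)
    (f' := fun t ↦ 6 * Q t * (1 - T t) * F n (θ t) ^ 2 *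
      (sin (θ t) * (sin (θ t) + cos (θ t))) + 2 * n * (T t * F n (θ t)))
    (fun s hs ↦ by
      have hs' : s ∈ Set.Icc 0 a := ⟨hs.1, hs.2.trans ht.2⟩
      obtain ⟨h1, -, h3⟩ := h s hs'
      have hne := (hQ2 s hs').ne'
      refine ((((h3.pow 2).sub_const 1).log hne).sub (h1.const_mul (2 * (n : ℝ)))).congr_deriv ?_
      simp only [Pi.pow_apply, Nat.cast_ofNat, Nat.add_one_sub_one, pow_one]
      field_simp
      ring)
    (fun s hs ↦ by
      have hs' : s ∈ Set.Icc 0 a := ⟨hs.1, hs.2.trans ht.2⟩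
      have a1 := hQp s hs'
      have a2 : 0 ≤ 1 - T s := by linarith [hTl s hs']
      have a5 := hTp s hs'
      obtain ⟨b1, b2⟩ := hθm s hs'
      have hsin : sin (θ s) ≤ 0 := sin_nonpos_of_nonpos_of_neg_pi_le b2 (by linarith [pi_pos])
      have hcos : 0 ≤ cos (θ s) := cos_nonneg_of_mem_Icc ⟨by linarith [pi_pos], by linarith [pi_pos]⟩
      have hcos2 : 0 ≤ cos (2 * θ s) :=
        cos_nonneg_of_mem_Icc ⟨by linarith [pi_pos], by linarith [pi_pos]⟩
      have hsum : 0 ≤ sin (θ s) + cos (θ s) := by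
        rw [cos_two_mul'] at hcos2
        nlinarith
      have hneg : 6 * Q s * (1 - T s) * F n (θ s) ^ 2 *
          (sin (θ s) * (sin (θ s) + cos (θ s))) ≤ 0 :=
        mul_nonpos_of_nonneg_of_nonpos (by positivity) (mul_nonpos_of_nonpos_of_nonneg hsin hsum)
      have hTF : T s * F n (θ s) ≤ n := by
        have := one_le_F hn (θ s)
        calc _ ≤ 1 * (n : ℝ) := by
              gcongr
              · exact (hTl s hs').le
              · exact F_le hn _
          _ = n := one_mul _
      nlinarith)
  simp only [hθ, mul_zero, sub_zero] at key
  have hlog : log (Q t ^ 2 - 1) ≤ log (Q 0 ^ 2 - 1) + 2 * n ^ 2 * a := by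
    have e1 : 2 * n * θ t ≤ 0 := mul_nonpos_of_nonneg_of_nonpos (by positivity) (hθm t ht).2
    have e2 : 2 * (n : ℝ) ^ 2 * t ≤ 2 * n ^ 2 * a := by gcongr; exact ht.2
    linarith
  have hexp := (log_le_iff_le_exp (hQ2 t ht)).mp hlog
  have := exp_pos (log (Q 0 ^ 2 - 1) + 2 * n ^ 2 * a)
  exact abs_le_of_sq_le_sq (by nlinarith) (by positivity)

end SolvesUpTo

theorem half_le_cos_sq {x : ℝ} (hx : |x| < 1 / 2) : 1 / 2 ≤ cos x ^ 2 := by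
  have h1 := one_sub_sq_div_two_le_cos (x := x)
  have h2 : x ^ 2 < (1 / 2) ^ 2 := sq_lt_sq' (by linarith [(abs_lt.mp hx).1]) (abs_lt.mp hx).2
  nlinarith

/-- Solutions with `T = 0` cannot stay near an equilibrium with `Q < 0`. -/
theorem not_forall_near_of_neg {n : ℕ} (hn : 1 ≤ n) {Qs : ℝ} (hQs : Qs < 0) {θ T Q : ℝ → ℝ}
    (h : ∀ a, SolvesUpTo n a θ T Q) (hT : T 0 = 0) (hθ0 : 0 < θ 0) (hθ : ∀ t, 0 ≤ t → |θ t| < 1 / 2)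
    (hQ : ∀ t, 0 ≤ t → |Q t - Qs| < |Qs| / 2) : False := by
  have hn0 : (0 : ℝ) < n := by positivity
  rw [abs_of_neg hQs] at hQ
  have hsin0 : 0 < sin (θ 0) :=
    sin_pos_of_pos_of_lt_pi hθ0 (by linarith [(abs_lt.mp (hθ 0 le_rfl)).2, pi_gt_three])
  have hs : ∀ a, ∀ t ∈ Set.Icc 0 a,
      HasDerivAt (fun t ↦ sin (θ t)) (-3 * Q t * F n (θ t) ^ 2 * cos (θ t) ^ 2 / n * sin (θ t)) t :=
    fun a t ht ↦ by
      have h1 := (h a t ht).1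
      rw [(h a).T_eq_zero hn hT t ht] at h1
      exact h1.sin.congr_deriv (by ring)
  have hpos : ∀ t, 0 ≤ t → 0 < sin (θ t) := fun t ht ↦ by
    have := (h t).continuousOn_F hn
    have := (h t).continuousOn_θ
    have := (h t).continuousOn_Q
    obtain ⟨c, hc, e⟩ := exists_pos_eq_mul_of_hasDerivAt_mul (y := fun t ↦ sin (θ t))
      (g := fun t ↦ -3 * Q t * F n (θ t) ^ 2 * cos (θ t) ^ 2 / n) (by fun_prop) (hs t) t ⟨ht, le_rfl⟩
    rw [e]; positivity
  set k : ℝ := 3 * (-Qs / 2) * 1 * (1 / 2) / n with hk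
  have hkpos : 0 < k := by
    have : 0 < -Qs := by linarith
    positivity
  have key : ∀ a, 0 ≤ a → log (sin (θ 0)) + k * a ≤ 0 := fun a ha ↦ by
    refine (add_mul_le_of_le_hasDerivAt (f := fun t ↦ log (sin (θ t))) ha
      (fun t ht ↦ (hs a t ht).log (hpos t ht.1).ne') fun t ht ↦ ?_).trans
      (log_nonpos (hpos a ha).le (sin_le_one _))
    rw [mul_div_cancel_right₀ _ (hpos t ht.1).ne', hk]
    have h1 := abs_lt.mp (hQ t ht.1)
    have h2 : 1 ≤ F n (θ t) ^ 2 := one_le_pow₀ (one_le_F hn _)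
    have h3 := half_le_cos_sq (hθ t ht.1)
    have h4 : 3 * (-Qs / 2) ≤ -3 * Q t := by linarith [h1.2]
    have h5 : 0 ≤ -3 * Q t := by linarith
    gcongr
  have := key ((1 - log (sin (θ 0))) / k) (div_nonneg
    (by linarith [log_nonpos hsin0.le (sin_le_one (θ 0))]) hkpos.le)
  rw [mul_div_cancel₀ _ hkpos.ne'] at this
  linarith

/-- Solutions with `T > 0` cannot stay near an equilibrium with `Q > 0`. -/
theorem not_forall_near_of_pos {n : ℕ} (hn : 1 ≤ n) {Qs : ℝ} (hQs : 0 < Qs) {θ T Q : ℝ → ℝ}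
    (h : ∀ a, SolvesUpTo n a θ T Q) (hT0 : 0 < T 0) (hT : ∀ t, 0 ≤ t → |T t| < 1 / 2)
    (hθ : ∀ t, 0 ≤ t → |θ t| < 1 / 2) (hQ : ∀ t, 0 ≤ t → |Q t - Qs| < |Qs| / 2) : False := by
  have hn0 : (0 : ℝ) < n := by positivity
  rw [abs_of_pos hQs] at hQ
  have hTpos : ∀ t, 0 ≤ t → 0 < T t := fun t ht ↦ (h t).T_pos hn hT0 t ⟨ht, le_rfl⟩
  have hTmono : ∀ t, 0 ≤ t → T 0 ≤ T t := fun t ht ↦ by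
    have := add_mul_le_of_le_hasDerivAt (k := 0) ht (fun s hs ↦ (h t s hs).2.1) fun s hs ↦ by
      have h1 := hTpos s hs.1
      have h2 : 0 ≤ Q s := by linarith [(abs_lt.mp (hQ s hs.1)).1]
      positivity
    linarith
  set A : ℝ := 9 / 2 * Qs with hA
  set k : ℝ := 3 * (Qs / 2) * (1 / 4) * T 0 * 1 / n with hk
  have hkpos : 0 < k := by positivity
  set κ : ℝ := A ^ 2 / (2 * T 0 * k) with hκ
  have hκpos : 0 ≤ κ := by positivity
  have key : ∀ a, 0 ≤ a → (κ * T 0 - θ 0) + T 0 / 2 * a ≤ κ * T a - θ a := fun a ha ↦ by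
    refine add_mul_le_of_le_hasDerivAt (f := fun t ↦ κ * T t - θ t) ha
      (fun t ht ↦ ((h a t ht).2.1.const_mul κ).sub (h a t ht).1) fun t ht ↦ ?_
    have hT2 := (abs_lt.mp (hT t ht.1)).2
    have hTp := hTpos t ht.1
    have hTm := hTmono t ht.1
    have hQt := abs_lt.mp (hQ t ht.1)
    have hF := one_le_F hn (θ t)
    have hQ1 : Qs / 2 ≤ Q t := by linarith
    have hQ2 : Q t ≤ 3 / 2 * Qs := by linarith
    have hQ0 : 0 ≤ Q t := by linarith
    have b1 : k * sin (θ t) ^ 2 ≤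
        3 * Q t * (T t - 1) ^ 2 * T t * (F n (θ t) ^ 2 * sin (θ t) ^ 2) / n := by
      calc _ = 3 * (Qs / 2) * (1 / 4) * T 0 * (1 * sin (θ t) ^ 2) / n := by rw [hk]; ring
        _ ≤ _ := by
          gcongr
          · nlinarith
          · exact one_le_pow₀ hF
    have b2 : 3 * Q t * (T t - 1) * F n (θ t) ^ 2 * (sin (θ t) * cos (θ t)) / n
        ≤ A * |sin (θ t)| := by
      refine (le_abs_self _).trans ?_
      rw [abs_div, abs_of_pos hn0, div_le_iff₀ hn0]
      simp only [abs_mul, abs_pow, sq_abs, abs_of_pos (three_pos : (0 : ℝ) < 3), abs_of_nonneg hQ0]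
      have e1 : |T t - 1| ≤ 1 := by rw [abs_le]; constructor <;> linarith
      calc _ ≤ 3 * (3 / 2 * Qs) * 1 * n * (|sin (θ t)| * 1) := by
            gcongr
            · exact F_sq_le _
            · exact abs_cos_le_one _
        _ = _ := by rw [hA]; ring
    have b3 : T 0 ≤ T t * F n (θ t) := by nlinarith
    have b4 : κ * (k * sin (θ t) ^ 2) = A ^ 2 * |sin (θ t)| ^ 2 / (2 * T 0) := by
      rw [hκ, sq_abs]; field_simp
    have b5 : A * |sin (θ t)| - T 0 / 2 ≤ A ^ 2 * |sin (θ t)| ^ 2 / (2 * T 0) := by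
      rw [le_div_iff₀ (by positivity)]
      nlinarith [sq_nonneg (A * |sin (θ t)| - T 0)]
    have b6 := mul_le_mul_of_nonneg_left b1 hκpos
    linarith
  have hb : ∀ a, 0 ≤ a → T 0 / 2 * a ≤ κ + 1 := fun a ha ↦ by
    have h1 := key a ha
    have h2 := abs_lt.mp (hθ a ha)
    have h3 := abs_lt.mp (hθ 0 le_rfl)
    have h4 : κ * T a ≤ κ * 1 := by gcongr; linarith [(abs_lt.mp (hT a ha)).2]
    have h5 : 0 ≤ κ * T 0 := by positivity
    linarith
  have := hb ((κ + 2) / (T 0 / 2)) (by positivity)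
  rw [mul_div_cancel₀ _ (by positivity)] at this
  linarith

/-- Arbitrarily close to `(0, 0, Qs)` there is a starting point of a global solution that has
`T = 0 < θ` if `Qs < 0`, and `T > 0` if `Qs > 0`. -/
theorem exists_global_solution_near {n : ℕ} (hn : 1 ≤ n) {Qs δ : ℝ} (hQ0 : Qs ≠ 0) (hQ1 : Qs ≠ 1)
    (hδ : 0 < δ) :
    ∃ γ : ℝ → ℝ × ℝ × ℝ, (∀ t, 0 ≤ t → HasDerivAt γ (X8 n (γ t)) t) ∧
      ‖γ 0 - (0, 0, Qs)‖ < δ ∧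
      (Qs < 0 ∧ 0 < (γ 0).1 ∧ (γ 0).2.1 = 0 ∨ 0 < Qs ∧ 0 < (γ 0).2.1) := by
  have hglobal : ∀ (x₀ : ℝ × ℝ × ℝ), 0 ≤ x₀.2.1 → x₀.2.1 < 1 →
      (∀ N : ℝ, 0 < N → ∃ B, ∀ a, 0 ≤ a → a ≤ N → ∀ θ T Q : ℝ → ℝ, SolvesUpTo n a θ T Q →
        θ 0 = x₀.1 → T 0 = x₀.2.1 → Q 0 = x₀.2.2 → ∀ t ∈ Set.Icc 0 a, |Q t| ≤ B) →
      ∃ γ : ℝ → ℝ × ℝ × ℝ, γ 0 = x₀ ∧ ∀ t, 0 ≤ t → HasDerivAt γ (X8 n (γ t)) t := by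
    intro x₀ hT0 hT1 hB
    refine exists_global_solution_of_bounded (contDiff_X8 hn) x₀ fun N hN ↦ ?_
    obtain ⟨B, hB⟩ := hB N hN
    refine ⟨|x₀.1| + (3 * B + n) * N + 1 + B, fun a ha γ h0 hγ ↦ ?_⟩
    have hs := solvesUpTo_of_hasDerivAt hn hγ
    have hQ := hB a ha.1 ha.2 _ _ _ hs (by rw [h0]) (by rw [h0]) (by rw [h0])
    have hBn : 0 ≤ B := (abs_nonneg _).trans (hQ 0 ⟨le_rfl, ha.1⟩)
    have hT1' := hs.T_lt_one hn (by rw [h0]; exact hT1)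
    have hT0' : ∀ t ∈ Set.Icc 0 a, 0 ≤ (γ t).2.1 := fun t ht ↦ by
      obtain ⟨c, hc, e⟩ := hs.T_eq hn t ht
      rw [h0] at e
      rw [e]; positivity
    have := hs.norm_le hn ha.1 hT0' (fun t ht ↦ (hT1' t ht).le) hQ
    rw [h0] at this
    refine this.trans ?_
    gcongr
    exact ha.2
  rcases lt_or_gt_of_ne hQ0 with hneg | hpos
  · set η := min (δ / 2) 1 with hη
    have hηpos : 0 < η := by positivity
    obtain ⟨γ, h0, hγ⟩ := hglobal (η, 0, Qs) le_rfl zero_lt_one fun N _ ↦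
      ⟨1 + |Qs ^ 2 - 1| / cos η ^ (2 * n), fun a _ _ θ T Q hs e1 e2 e3 ↦ by
        have hc : 0 < cos η := cos_pos_of_mem_Ioo
          ⟨by linarith [pi_pos], by linarith [min_le_right (δ / 2) 1, pi_gt_three]⟩
        have := hs.abs_Q_le_of_T_eq_zero hn e2 (by rw [e1]; exact hc)
        rwa [e1, e3] at this⟩
    refine ⟨γ, hγ, ?_, Or.inl ⟨hneg, by rw [h0]; exact hηpos, by rw [h0]⟩⟩
    rw [h0]
    have : η < δ := by linarith [min_le_left (δ / 2) 1]
    simp [Prod.norm_def, abs_of_pos hηpos, this, hδ]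
  · obtain ⟨τ, hτ0, hτδ, hτ1, hτ⟩ : ∃ τ : ℝ, 0 < τ ∧ τ < δ ∧ τ < 1 ∧
        (1 < Qs → n ^ 2 ≤ (Qs ^ 2 - 1) * ((1 - τ) / τ) ^ 2) := by
      have hlim : Tendsto (fun τ : ℝ ↦ (1 - τ) / τ) (nhdsWithin 0 (Set.Ioi 0)) atTop := by
        have h1 : Tendsto (fun τ : ℝ ↦ τ⁻¹ + -1) (nhdsWithin 0 (Set.Ioi 0)) atTop :=
          tendsto_atTop_add_const_right _ _ tendsto_inv_nhdsGT_zero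
        refine h1.congr' ?_
        filter_upwards [self_mem_nhdsWithin] with τ hτ
        have : τ ≠ 0 := ne_of_gt hτ
        field_simp
        ring
      have hev : ∀ᶠ τ : ℝ in nhdsWithin 0 (Set.Ioi 0),
          1 < Qs → (n : ℝ) ^ 2 ≤ (Qs ^ 2 - 1) * ((1 - τ) / τ) ^ 2 := by
        by_cases hQ : 1 < Qs
        · have hc : 0 < Qs ^ 2 - 1 := by nlinarith
          filter_upwards [(((tendsto_pow_atTop two_ne_zero).comp hlim).const_mul_atTop
            hc).eventually_ge_atTop ((n : ℝ) ^ 2)] with τ h _ using h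
        · exact Eventually.of_forall fun _ h ↦ absurd h hQ
      obtain ⟨τ, h1, h2⟩ := (hev.and (Ioo_mem_nhdsGT (lt_min hδ one_pos))).exists
      exact ⟨τ, h2.1, h2.2.trans_le (min_le_left _ _), h2.2.trans_le (min_le_right _ _), h1⟩
    obtain ⟨γ, h0, hγ⟩ := hglobal (0, τ, Qs) hτ0.le hτ1 fun N _ ↦ by
      rcases lt_or_gt_of_ne hQ1 with hlt | hgt
      · exact ⟨1, fun a _ _ θ T Q hs _ _ e3 t ht ↦ (hs.abs_Q_lt_one hn (by
          rw [e3, abs_of_pos hpos]; exact hlt) t ht).le⟩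
      · refine ⟨1 + exp (log (Qs ^ 2 - 1) + 2 * n ^ 2 * N), fun a _ ha θ T Q hs e1 e2 e3 t ht ↦ ?_⟩
        simp only at e1 e2 e3
        have := hs.Q_le_of_one_lt hn (by rwa [e2]) (by rwa [e2]) (by rwa [e3]) e1
          (by rw [e2, e3]; exact hτ hgt) t ht
        rw [e3] at this
        refine this.trans ?_
        gcongr
    refine ⟨γ, hγ, ?_, Or.inr ⟨hpos, by rw [h0]; exact hτ0⟩⟩
    rw [h0]
    simp [Prod.norm_def, abs_of_pos hτ0, hτδ, hδ]

theorem stmt_9 (n : ℕ) (hn : 1 ≤ n) (Qs : ℝ) (hQ0 : Qs ≠ 0) (hQ1 : Qs ≠ 1) (hQm1 : Qs ≠ -1) :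
    X8 n (0, 0, Qs) = (0, 0, 0) ∧
      ¬ LyapunovStable (X8 n) (Set.univ : Set (ℝ × ℝ × ℝ)) (0, 0, Qs) := by
  refine ⟨by simp [X8], fun hstab ↦ ?_⟩
  have hε : 0 < min (1 / 2) (|Qs| / 2) := lt_min one_half_pos (half_pos (abs_pos.mpr hQ0))
  obtain ⟨δ, hδ, hγδ⟩ := hstab _ hε
  obtain ⟨γ, hγ, hclose, hcase⟩ := exists_global_solution_near hn hQ0 hQ1 hδ
  have hnear := hγδ γ (fun _ _ ↦ Set.mem_univ _) hγ hclose
  simp only [Prod.norm_def, Prod.fst_sub, Prod.snd_sub, sub_zero, Real.norm_eq_abs, max_lt_iff,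
    lt_min_iff] at hnear
  have hsol : ∀ a, SolvesUpTo n a (fun t ↦ (γ t).1) (fun t ↦ (γ t).2.1) (fun t ↦ (γ t).2.2) :=
    fun a ↦ solvesUpTo_of_hasDerivAt hn fun t ht ↦ hγ t ht.1
  rcases hcase with ⟨hneg, hθ0, hT0⟩ | ⟨hpos, hT0⟩
  · exact not_forall_near_of_neg hn hneg hsol hT0 hθ0 (fun t ht ↦ (hnear t ht).1.1)
      fun t ht ↦ (hnear t ht).2.2.2
  · exact not_forall_near_of_pos hn hpos hsol hT0 (fun t ht ↦ (hnear t ht).1.2.1)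
      (fun t ht ↦ (hnear t ht).1.1) fun t ht ↦ (hnear t ht).2.2.2
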